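/- (Abels–Margulis–Soifer, existence part.) Let p ≥ 2 be even and q = p − 1. Then there exists a subgroup Γ of the group of affine transformations of ℝ^{p+q} such that: (i) the linear part of every element of Γ preserves the bilinear form B_{p,q}(v,w) = Σ_{i=1}^{p} v_i w_i − Σ_{i=p+1}^{p+q} v_i w_i of signature (p,q); (ii) Γ is isomorphic to the free group of rank 2; and (iii) the natural action of Γ on ℝ^{p+q} is properly discontinuous. (That is, the standard representation of SO(p, p−1) with p even is not Milnor.) -/

import Mathlib

noncomputable section

/-- The vector space `ℝⁿ`. -/
abbrev V (n : ℕ) : Type := Fin n → ℝ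

/-- The group of affine transformations of `ℝⁿ` (invertible affine self-maps). -/
abbrev Aff (n : ℕ) : Type := V n ≃ᵃ[ℝ] V n

/-- An action (given by `act`) of `Γ` on a topological space `X` is properly discontinuous if
for all compact `K L ⊆ X`, only finitely many `γ` satisfy `act γ '' K ∩ L ≠ ∅`. -/
def ProperlyDisc {Γ : Type*} {X : Type*} [TopologicalSpace X] (act : Γ → X → X) : Prop :=
  ∀ K L : Set X, IsCompact K → IsCompact L → {γ : Γ | (act γ '' K ∩ L).Nonempty}.Finite

/-- The standard bilinear form of signature `(p,q)` on `ℝ^{p+q}`. -/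
def Bpq (p q : ℕ) (v w : Fin (p + q) → ℝ) : ℝ :=
  ∑ i : Fin (p + q), if (i : ℕ) < p then v i * w i else -(v i * w i)

/-- The linear map of `ℝⁿ` acting on the coordinates `i`, `j` by the matrix `!![c, s; s, c]`. -/
def boostMap {n : ℕ} (i j : Fin n) (c s : ℝ) : V n →ₗ[ℝ] V n where
  toFun x k := if k = i then c * x i + s * x j else if k = j then s * x i + c * x j else x k
  map_add' x y := by
    ext k
    simp only [Pi.add_apply]
    split_ifs <;> ring
  map_smul' r x := by
    ext k
    simp only [Pi.smul_apply, smul_eq_mul, RingHom.id_apply]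
    split_ifs <;> ring

theorem boostMap_comp_neg {n : ℕ} {i j : Fin n} (hij : i ≠ j) {c s : ℝ} (h : c ^ 2 - s ^ 2 = 1) :
    boostMap i j c s ∘ₗ boostMap i j c (-s) = LinearMap.id := by
  refine LinearMap.ext fun x => funext fun k => ?_
  simp only [boostMap, LinearMap.comp_apply, LinearMap.coe_mk, AddHom.coe_mk, LinearMap.id_apply,
    if_true, if_neg hij.symm]
  split_ifs with h1 h2
  · subst h1; linear_combination x k * h
  · subst h2; linear_combination x k * h
  · rfl

/-- The hyperbolic rotation in the coordinates `i`, `j`. -/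
def boost {n : ℕ} (i j : Fin n) (hij : i ≠ j) (c s : ℝ) (h : c ^ 2 - s ^ 2 = 1) :
    V n ≃ₗ[ℝ] V n :=
  LinearEquiv.ofLinearMap (boostMap i j c s) (boostMap i j c (-s)) (boostMap_comp_neg hij h)
    (by simpa using boostMap_comp_neg hij (s := -s) (by simpa using h))

/-- The Lorentz transformations of `ℝ³` attached to the two generators, acting on the coordinates
singled out by `f`, followed by a unit translation along their axes. -/
def gen {n : ℕ} (f : Fin 3 ↪ Fin n) : Fin 2 → Aff n :=
  ![AffineEquiv.constVAdd ℝ (V n) (Pi.single (f 0) 1) *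
      (boost (f 1) (f 2) (by simp) (41 / 9) (40 / 9) (by norm_num)).toAffineEquiv,
    AffineEquiv.constVAdd ℝ (V n) (Pi.single (f 1) 1) *
      (boost (f 0) (f 2) (by simp) (41 / 9) (-(40 / 9)) (by norm_num)).toAffineEquiv]

/-- The affine map attached to a letter of the free group on two generators. -/
def letter {n : ℕ} (f : Fin 3 ↪ Fin n) (l : Fin 2 × Bool) : Aff n :=
  cond l.2 (gen f l.1) (gen f l.1)⁻¹

/-- The action on `ℝ²` of a letter, normalized to have determinant `9`. -/
def planeAct : Fin 2 × Bool → ℝ × ℝ → ℝ × ℝ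
  | (0, true), v => (9 * v.1, v.2)
  | (0, false), v => (v.1, 9 * v.2)
  | (1, true), v => (5 * v.1 + 4 * v.2, 4 * v.1 + 5 * v.2)
  | (1, false), v => (5 * v.1 - 4 * v.2, 5 * v.2 - 4 * v.1)

/-- Coordinates on `ℝ²` adapted to the eigendirections of `planeAct l`, the expanding one first. -/
def eigenCoord : Fin 2 × Bool → ℝ × ℝ → ℝ × ℝ
  | (0, true), v => (v.1, v.2)
  | (0, false), v => (v.2, v.1)
  | (1, true), v => (v.1 + v.2, v.1 - v.2)
  | (1, false), v => (v.1 - v.2, v.1 + v.2)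

/-- The inverse of a letter. -/
def invLetter (l : Fin 2 × Bool) : Fin 2 × Bool := (l.1, !l.2)

/-- The cone around the attracting direction of a letter. -/
def InnerCone (l : Fin 2 × Bool) (v : ℝ × ℝ) : Prop :=
  9 * (eigenCoord l v).2 ^ 2 < (eigenCoord l v).1 ^ 2

/-- A cone avoiding a neighbourhood of `InnerCone l`. -/
def OuterCone (l : Fin 2 × Bool) (v : ℝ × ℝ) : Prop :=
  4 * (eigenCoord l v).1 ^ 2 < 25 * (eigenCoord l v).2 ^ 2

/-- A vector of `ℝ²` lying outside all the cones `InnerCone l`. -/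
def base : ℝ × ℝ := (12, 5)

/-- For `X ∈ 𝔰𝔩₂(ℝ)` with coordinates `x ∘ f`, the value `det (X ξ, η) / det (ξ, η)`. -/
def pairing {n : ℕ} (f : Fin 3 ↪ Fin n) (η ξ : ℝ × ℝ) (x : V n) : ℝ :=
  (x (f 0) * (ξ.1 * η.2 + ξ.2 * η.1) + x (f 1) * (ξ.2 * η.2 - ξ.1 * η.1)
    + x (f 2) * (ξ.2 * η.2 + ξ.1 * η.1)) / (ξ.1 * η.2 - ξ.2 * η.1)

theorem gen_zero_apply {n : ℕ} (f : Fin 3 ↪ Fin n) (x : V n) :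
    gen f 0 x (f 0) = x (f 0) + 1 ∧ gen f 0 x (f 1) = 41 / 9 * x (f 1) + 40 / 9 * x (f 2) ∧
      gen f 0 x (f 2) = 40 / 9 * x (f 1) + 41 / 9 * x (f 2) := by
  simp [gen, boost, boostMap, AffineEquiv.mul_def, add_comm]

theorem gen_one_apply {n : ℕ} (f : Fin 3 ↪ Fin n) (x : V n) :
    gen f 1 x (f 0) = 41 / 9 * x (f 0) - 40 / 9 * x (f 2) ∧ gen f 1 x (f 1) = x (f 1) + 1 ∧
      gen f 1 x (f 2) = 41 / 9 * x (f 2) - 40 / 9 * x (f 0) := by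
  refine ⟨?_, ?_, ?_⟩ <;> simp [gen, boost, boostMap, AffineEquiv.mul_def] <;> ring

theorem div_eq_div_add_div {a b d e d₁ d₂ k : ℝ} (hk : k ≠ 0) (h₁ : d₁ = d) (h₂ : d₂ = k * d)
    (h : k * a = k * b + e) : a / d = b / d₁ + e / d₂ := by
  rw [h₁, h₂, ← mul_div_mul_left a d hk, ← mul_div_mul_left b d hk, h, add_div]

theorem letter_true_apply {n : ℕ} (f : Fin 3 ↪ Fin n) (i : Fin 2) (x : V n) :
    letter f (i, true) x = gen f i x := rfl

theorem letter_false_apply {n : ℕ} (f : Fin 3 ↪ Fin n) (i : Fin 2) (x : V n) :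
    letter f (i, false) (gen f i x) = x :=
  (gen f i).symm_apply_apply x

theorem pairing_letter {n : ℕ} (f : Fin 3 ↪ Fin n) (l : Fin 2 × Bool) (η ξ : ℝ × ℝ) (x : V n) :
    pairing f η (planeAct l ξ) (letter f l x) =
      pairing f (planeAct (invLetter l) η) ξ x +
        ((eigenCoord l (planeAct l ξ)).1 * (eigenCoord l η).2
          + (eigenCoord l (planeAct l ξ)).2 * (eigenCoord l η).1) /
        ((eigenCoord l (planeAct l ξ)).1 * (eigenCoord l η).2
          - (eigenCoord l (planeAct l ξ)).2 * (eigenCoord l η).1) := by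
  obtain ⟨i, b⟩ := l
  cases b
  · obtain ⟨x, rfl⟩ := (gen f i).surjective x
    rw [letter_false_apply]
    fin_cases i
    · obtain ⟨h0, h1, h2⟩ := gen_zero_apply f x
      refine div_eq_div_add_div (k := -1) (by norm_num) ?_ ?_ ?_ <;>
        simp [planeAct, eigenCoord, invLetter, h0, h1, h2] <;> ring
    · obtain ⟨h0, h1, h2⟩ := gen_one_apply f x
      refine div_eq_div_add_div (k := 2) (by norm_num) ?_ ?_ ?_ <;>
        simp [planeAct, eigenCoord, invLetter, h0, h1, h2] <;> ring
  · rw [letter_true_apply]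
    fin_cases i
    · obtain ⟨h0, h1, h2⟩ := gen_zero_apply f x
      refine div_eq_div_add_div (k := 1) (by norm_num) ?_ ?_ ?_ <;>
        simp [planeAct, eigenCoord, invLetter, h0, h1, h2] <;> ring
    · obtain ⟨h0, h1, h2⟩ := gen_one_apply f x
      refine div_eq_div_add_div (k := -2) (by norm_num) ?_ ?_ ?_ <;>
        simp [planeAct, eigenCoord, invLetter, h0, h1, h2] <;> ring

theorem InnerCone.outer {l m : Fin 2 × Bool} (h : l ≠ m) {v : ℝ × ℝ} (hv : InnerCone l v) :
    OuterCone m v := by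
  obtain ⟨i, b⟩ := l
  obtain ⟨j, c⟩ := m
  fin_cases i <;> fin_cases j <;> cases b <;> cases c <;>
    simp [InnerCone, OuterCone, eigenCoord] at h hv ⊢ <;>
    nlinarith [sq_nonneg (v.1 - v.2), sq_nonneg (v.1 + v.2), sq_nonneg (v.1 - 2 * v.2),
      sq_nonneg (v.1 + 2 * v.2), sq_nonneg (2 * v.1 - v.2), sq_nonneg (2 * v.1 + v.2)]

theorem outer_base (l : Fin 2 × Bool) : OuterCone l base := by
  obtain ⟨i, b⟩ := l
  fin_cases i <;> cases b <;> norm_num [OuterCone, eigenCoord, base]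

theorem inner_planeAct {l : Fin 2 × Bool} {v : ℝ × ℝ} (hv : OuterCone (invLetter l) v) :
    InnerCone l (planeAct l v) := by
  obtain ⟨i, b⟩ := l
  fin_cases i <;> cases b <;> simp [InnerCone, OuterCone, eigenCoord, planeAct, invLetter] at hv ⊢ <;>
    nlinarith [sq_nonneg v.1, sq_nonneg v.2, sq_nonneg (v.1 + v.2), sq_nonneg (v.1 - v.2)]

theorem invLetter_invLetter (l : Fin 2 × Bool) : invLetter (invLetter l) = l := by simp [invLetter]

theorem one_div_le_of_inner_outer {l : Fin 2 × Bool} {v w : ℝ × ℝ} (hv : InnerCone l v)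
    (hw : OuterCone l w) :
    1 / 12 ≤ ((eigenCoord l v).1 * (eigenCoord l w).2 + (eigenCoord l v).2 * (eigenCoord l w).1) /
      ((eigenCoord l v).1 * (eigenCoord l w).2 - (eigenCoord l v).2 * (eigenCoord l w).1) := by
  unfold InnerCone at hv
  unfold OuterCone at hw
  generalize eigenCoord l v = a at *
  generalize eigenCoord l w = b at *
  set X := a.1 * b.2 with hX
  set Y := a.2 * b.1 with hY
  have hXY : 36 * Y ^ 2 < 25 * X ^ 2 := by
    have h1 : 0 < a.1 ^ 2 := lt_of_le_of_lt (by positivity) hv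
    have h2 := mul_lt_mul_of_pos_left hw h1
    have h3 := mul_le_mul_of_nonneg_right hv.le (sq_nonneg b.1)
    rw [hX, hY, mul_pow, mul_pow]
    nlinarith
  have hne : X - Y ≠ 0 := by
    intro h
    rw [sub_eq_zero.1 h] at hXY
    nlinarith [sq_nonneg Y]
  have hpos : 0 < (X - Y) ^ 2 := by positivity
  have : (X + Y) / (X - Y) = (X + Y) * (X - Y) / (X - Y) ^ 2 := by field_simp
  rw [this, div_le_div_iff₀ (by norm_num) hpos]
  nlinarith [sq_nonneg (5 * X + 6 * Y), sq_nonneg (X + Y), sq_nonneg (X - Y)]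

/-- The vector `ρ(w) base`, up to scaling. -/
def forward (w : List (Fin 2 × Bool)) : ℝ × ℝ := w.foldr planeAct base

/-- The vector `ρ(w)⁻¹ η`, up to scaling. -/
def backward (w : List (Fin 2 × Bool)) (η : ℝ × ℝ) : ℝ × ℝ :=
  w.foldl (fun v l => planeAct (invLetter l) v) η

theorem invLetter_ne_of_isReduced {l m : Fin 2 × Bool} {w : List (Fin 2 × Bool)}
    (h : FreeGroup.IsReduced (l :: m :: w)) : invLetter l ≠ m := by
  rintro rfl
  simp [FreeGroup.IsReduced, invLetter] at h

theorem inner_forward {l : Fin 2 × Bool} {w : List (Fin 2 × Bool)}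
    (h : FreeGroup.IsReduced (l :: w)) : InnerCone l (forward (l :: w)) := by
  induction w generalizing l with
  | nil => exact inner_planeAct (outer_base _)
  | cons m w ih =>
    exact inner_planeAct ((ih (List.IsChain.tail h)).outer (invLetter_ne_of_isReduced h).symm)

theorem inner_backward {l : Fin 2 × Bool} {w : List (Fin 2 × Bool)} {η : ℝ × ℝ}
    (h : FreeGroup.IsReduced (l :: w)) (hη : OuterCone l η) : ∃ m, InnerCone m (backward (l :: w) η) := by
  induction w generalizing l η with
  | nil => exact ⟨invLetter l, inner_planeAct (by rwa [invLetter_invLetter])⟩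
  | cons m w ih =>
    exact ih (List.IsChain.tail h)
      ((inner_planeAct (by rwa [invLetter_invLetter])).outer (invLetter_ne_of_isReduced h))

theorem le_pairing {n : ℕ} (f : Fin 3 ↪ Fin n) {w : List (Fin 2 × Bool)} {η : ℝ × ℝ}
    (h : FreeGroup.IsReduced w) (hη : ∀ l ∈ w.head?, OuterCone l η) (x : V n) :
    pairing f (backward w η) base x + w.length / 12 ≤
      pairing f η (forward w) ((w.map (letter f)).prod x) := by
  induction w generalizing η with
  | nil => simp [forward, backward]
  | cons l w ih =>
    have hl : OuterCone l η := hη l rfl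
    have hstep := pairing_letter f l η (forward w) ((w.map (letter f)).prod x)
    have hpos := one_div_le_of_inner_outer (inner_forward h) hl
    have hrec := ih (η := planeAct (invLetter l) η) (List.IsChain.tail h) fun m hm => by
      cases w with
      | nil => simp at hm
      | cons m' w =>
        obtain rfl : m' = m := by simpa using hm
        exact (inner_planeAct (by rwa [invLetter_invLetter])).outer (invLetter_ne_of_isReduced h)
    simp only [forward, backward, List.foldr_cons, List.foldl_cons, List.map_cons, List.prod_cons,
      List.length_cons, AffineEquiv.coe_mul, Function.comp_apply] at hstep hpos hrec ⊢
    push_cast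
    linarith

theorem sq_le_of_inner {l : Fin 2 × Bool} {v : ℝ × ℝ} (hv : InnerCone l v) :
    v.1 ^ 2 + v.2 ^ 2 ≤ 4 * (v.1 * 5 - v.2 * 12) ^ 2 := by
  obtain ⟨i, b⟩ := l
  fin_cases i <;> cases b <;> simp [InnerCone, eigenCoord] at hv ⊢
  · nlinarith [sq_nonneg (549 * v.1 - 240 * v.2), sq_nonneg v.2]
  · nlinarith [sq_nonneg (79 * v.1 - 240 * v.2), sq_nonneg v.2]
  · nlinarith [sq_nonneg (179 * v.1 - 140 * v.2), sq_nonneg v.2]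
  · nlinarith [sq_nonneg (179 * v.1 - 340 * v.2), sq_nonneg v.2]

theorem abs_pairing_le {n : ℕ} (f : Fin 3 ↪ Fin n) {l : Fin 2 × Bool} {v : ℝ × ℝ}
    (hv : InnerCone l v) {x : V n} {R : ℝ} (hx : ∀ i, |x i| ≤ R) :
    |pairing f base v x| ≤ 78 * R := by
  have hsq := sq_le_of_inner hv
  set d := v.1 * 5 - v.2 * 12 with hd
  have hd0 : 0 ≤ |d| := abs_nonneg d
  have hR : 0 ≤ R := (abs_nonneg _).trans (hx (f 0))
  have key : ∀ (i : Fin n) (t : ℝ), t ^ 2 ≤ 169 * (v.1 ^ 2 + v.2 ^ 2) →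
      |x i * t| ≤ R * (26 * |d|) := fun i t ht => by
    rw [abs_mul]
    refine mul_le_mul (hx i) ?_ (abs_nonneg t) hR
    refine abs_le_of_sq_le_sq ?_ (by positivity)
    rw [mul_pow, sq_abs]
    linarith
  have h0 := key (f 0) (v.1 * 5 + v.2 * 12) (by nlinarith [sq_nonneg (v.1 * 12 - v.2 * 5)])
  have h1 := key (f 1) (v.2 * 5 - v.1 * 12) (by nlinarith [sq_nonneg (v.1 * 5 + v.2 * 12)])
  have h2 := key (f 2) (v.2 * 5 + v.1 * 12) (by nlinarith [sq_nonneg (v.1 * 5 - v.2 * 12)])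
  simp only [pairing, base]
  rw [← hd, abs_div]
  refine div_le_of_le_mul₀ hd0 (by positivity) ?_
  refine (abs_add_three _ _ _).trans ?_
  linarith

theorem pairing_comm {n : ℕ} (f : Fin 3 ↪ Fin n) (η ξ : ℝ × ℝ) (x : V n) :
    pairing f η ξ x = -pairing f ξ η x := by
  simp only [pairing]
  rw [← div_neg]
  congr 1 <;> ring

/-- The affine action of the free group on two generators. -/
def affineRep {n : ℕ} (f : Fin 3 ↪ Fin n) : FreeGroup (Fin 2) →* Aff n := FreeGroup.lift (gen f)

theorem affineRep_eq_prod {n : ℕ} (f : Fin 3 ↪ Fin n) (g : FreeGroup (Fin 2)) :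
    affineRep f g = (g.toWord.map (letter f)).prod := by
  conv_lhs => rw [← FreeGroup.mk_toWord (x := g)]
  rfl

theorem length_toWord_le {n : ℕ} (f : Fin 3 ↪ Fin n) (g : FreeGroup (Fin 2)) {x : V n} {R : ℝ}
    (hx : ∀ i, |x i| ≤ R) (hgx : ∀ i, |affineRep f g x i| ≤ R) :
    (g.toWord.length : ℝ) ≤ 1872 * R := by
  have hR : 0 ≤ R := (abs_nonneg _).trans (hx (f 0))
  have hle := le_pairing f (FreeGroup.isReduced_toWord (x := g)) (η := base)
    (fun l _ => outer_base l) x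
  have hred := FreeGroup.isReduced_toWord (x := g)
  rw [← affineRep_eq_prod] at hle
  generalize g.toWord = w at hle hred ⊢
  cases w with
  | nil => simpa using hR
  | cons l w =>
    obtain ⟨m, hm⟩ := inner_backward hred (outer_base l)
    have h1 := abs_le.1 (abs_pairing_le f (inner_forward hred) hgx)
    have h2 := abs_le.1 (abs_pairing_le f hm hx)
    rw [pairing_comm] at hle
    linarith

theorem affineRep_injective {n : ℕ} (f : Fin 3 ↪ Fin n) : Function.Injective (affineRep f) := by
  rw [injective_iff_map_eq_one]
  intro g hg
  have h := length_toWord_le f g (x := 0) (R := 0) (by simp) (by simp [hg])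
  rw [mul_zero] at h
  rw [← FreeGroup.toWord_eq_nil_iff, ← List.length_eq_zero_iff]
  exact_mod_cast le_antisymm h (Nat.cast_nonneg _)

theorem properlyDisc_affineRep {n : ℕ} (f : Fin 3 ↪ Fin n) :
    ProperlyDisc (fun (γ : (affineRep f).range) (x : V n) => (γ : Aff n) x) := by
  intro K L hK hL
  obtain ⟨R, hR⟩ := (hK.union hL).isBounded.exists_norm_le
  obtain ⟨N, hN⟩ := exists_nat_ge (1872 * R)
  have hfin : {g : FreeGroup (Fin 2) | g.toWord.length ≤ N}.Finite :=
    (List.finite_length_le (Fin 2 × Bool) N).preimage FreeGroup.toWord_injective.injOn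
  refine (hfin.image (affineRep f).rangeRestrict).subset ?_
  rintro ⟨_, g, rfl⟩ ⟨_, ⟨x, hxK, rfl⟩, hxL⟩
  refine ⟨g, ?_, rfl⟩
  have h := length_toWord_le f g
    (fun i => (norm_le_pi_norm x i).trans (hR x (Or.inl hxK)))
    (fun i => (norm_le_pi_norm _ i).trans (hR _ (Or.inr hxL)))
  exact_mod_cast h.trans hN

theorem bpq_boostMap {p q : ℕ} {i j : Fin (p + q)} (hi : (i : ℕ) < p) (hj : ¬ (j : ℕ) < p)
    {c s : ℝ} (h : c ^ 2 - s ^ 2 = 1) (v w : V (p + q)) :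
    Bpq p q (boostMap i j c s v) (boostMap i j c s w) = Bpq p q v w := by
  have hij : j ≠ i := by rintro rfl; exact hj hi
  have split : ∀ v w : V (p + q), Bpq p q v w = v i * w i - v j * w j +
      ∑ k ∈ (Finset.univ.erase i).erase j,
        if (k : ℕ) < p then v k * w k else -(v k * w k) := fun v w => by
    rw [Bpq, ← Finset.add_sum_erase _ _ (Finset.mem_univ i),
      ← Finset.add_sum_erase _ _ (Finset.mem_erase.2 ⟨hij, Finset.mem_univ j⟩),
      if_pos hi, if_neg hj]
    ring
  rw [split, split v w]
  congr 1
  · simp only [boostMap, LinearMap.coe_mk, AddHom.coe_mk, if_true, if_neg hij]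
    linear_combination (v i * w i - v j * w j) * h
  · refine Finset.sum_congr rfl fun k hk => ?_
    simp only [Finset.mem_erase, Finset.mem_univ, and_true] at hk
    simp [boostMap, hk.1, hk.2]

/-- The affine transformations whose linear part preserves the form of signature `(p, q)`. -/
def affineIsometries (p q : ℕ) : Subgroup (Aff (p + q)) where
  carrier := {g | ∀ v w, Bpq p q (g.linear v) (g.linear w) = Bpq p q v w}
  one_mem' _ _ := rfl
  mul_mem' {a b} ha hb v w := (ha _ _).trans (hb v w)
  inv_mem' {a} ha v w := by
    have h := ha (a.linear.symm v) (a.linear.symm w)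
    simp only [LinearEquiv.apply_symm_apply] at h
    exact h.symm

theorem gen_mem_affineIsometries {p q : ℕ} (f : Fin 3 ↪ Fin (p + q)) (h0 : (f 0 : ℕ) < p)
    (h1 : (f 1 : ℕ) < p) (h2 : ¬ (f 2 : ℕ) < p) (i : Fin 2) : gen f i ∈ affineIsometries p q := by
  intro v w
  fin_cases i
  · exact bpq_boostMap h1 h2 (by norm_num) v w
  · exact bpq_boostMap h0 h2 (by norm_num) v w

/-- (Abels–Margulis–Soifer, existence part.) For `p ≥ 2` even and `q = p − 1`, there is a
properly discontinuous affine action of the rank-2 free group on `ℝ^{p+q}` whose linear parts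
preserve the form of signature `(p, q)`; i.e. the standard representation of `SO(p, p−1)` with
`p` even is not Milnor. -/
theorem ams_standard_rep_not_milnor
    (p : ℕ) (hp : 2 ≤ p) (hpeven : Even p) :
    ∃ Γ : Subgroup (Aff (p + (p - 1))),
      (∀ g ∈ Γ, ∀ v w : V (p + (p - 1)),
        Bpq p (p - 1) ((g : Aff (p + (p - 1))).linear v) ((g : Aff (p + (p - 1))).linear w)
          = Bpq p (p - 1) v w) ∧
      Nonempty (Γ ≃* FreeGroup (Fin 2)) ∧
      ProperlyDisc (fun (γ : Γ) (x : V (p + (p - 1))) => (γ : Aff (p + (p - 1))) x) := by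
  let f : Fin 3 ↪ Fin (p + (p - 1)) :=
    ⟨![⟨0, by omega⟩, ⟨1, by omega⟩, ⟨p, by omega⟩], by
      intro i j h
      fin_cases i <;> fin_cases j <;> simp at h ⊢ <;> omega⟩
  have h0 : (f 0 : ℕ) = 0 := rfl
  have h1 : (f 1 : ℕ) = 1 := rfl
  have h2 : (f 2 : ℕ) = p := rfl
  refine ⟨(affineRep f).range, ?_, ⟨(MonoidHom.ofInjective (affineRep_injective f)).symm⟩,
    properlyDisc_affineRep f⟩
  have hle : (affineRep f).range ≤ affineIsometries p (p - 1) := by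
    refine FreeGroup.range_lift_le ?_
    rintro _ ⟨i, rfl⟩
    exact gen_mem_affineIsometries f (by omega) (by omega) (by omega) i
  exact fun g hg => hle hg
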